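/- Let f(x,y) = −54y² − 103xy − 26x² − 88y³ + 45xy² + 91x²y − 96x³ − 12y⁴ + 43xy³ + 6x²y² + 11x³y + 49x⁴ + 22y⁵ − 20xy⁴ − 38x²y³ − 14x³y² + 45x⁴y + 76x⁵. Then the hessian curve Z = {(x,y) ∈ ℝ² : Hess(f)(x,y) = 0} has exactly 9 connected components, of which exactly 7 are bounded subsets of ℝ² (ovals) and exactly 2 are unbounded. -/

import Mathlib

open MvPolynomial

/-- The hessian determinant of a polynomial in two variables over the reals:
`Hess f = f_xx * f_yy - f_xy ^ 2` (with formal partial derivatives). -/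
noncomputable def Hess (f : MvPolynomial (Fin 2) ℝ) : MvPolynomial (Fin 2) ℝ :=
  pderiv 0 (pderiv 0 f) * pderiv 1 (pderiv 1 f) - (pderiv 0 (pderiv 1 f)) ^ 2

/-- The set of connected components of a set `Z ⊆ ℝ × ℝ` (with its subspace
topology), viewed as subsets of `ℝ × ℝ`. -/
def components (Z : Set (ℝ × ℝ)) : Set (Set (ℝ × ℝ)) :=
  {C | ∃ p ∈ Z, C = connectedComponentIn Z p}

/-- The polynomial `f` of the statement. -/
noncomputable def f : MvPolynomial (Fin 2) ℝ :=
  -54 * (X 1)^2 - 103 * (X 0)*(X 1) - 26 * (X 0)^2 - 88 * (X 1)^3 + 45 * (X 0)*(X 1)^2 + 91 * (X 0)^2*(X 1) - 96 * (X 0)^3 - 12 * (X 1)^4 + 43 * (X 0)*(X 1)^3 + 6 * (X 0)^2*(X 1)^2 + 11 * (X 0)^3*(X 1) + 49 * (X 0)^4 + 22 * (X 1)^5 - 20 * (X 0)*(X 1)^4 - 38 * (X 0)^2*(X 1)^3 - 14 * (X 0)^3*(X 1)^2 + 45 * (X 0)^4*(X 1) + 76 * (X 0)^5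

/-- The hessian curve of `f` in `ℝ²`. -/
noncomputable def Z : Set (ℝ × ℝ) := {p | eval ![p.1, p.2] (Hess f) = 0}

namespace HessianCurve

/-! ### A subdivision test for positivity of bivariate polynomials on boxes

The recursions that are evaluated by the kernel are given by recursors, which it reduces faster
than compiled pattern matching. -/

/-- Value at `t` of the polynomial with coefficient list `l`. -/
def ev1 : List ℕ → ℝ → ℝ
  | [], _ => 0
  | a :: l, t => a + t * ev1 l t

/-- Value at `(s, t)` of the bivariate polynomial whose coefficient of `s ^ i` is the `i`-th row. -/
def ev2 : List (List ℕ) → ℝ → ℝ → ℝ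
  | [], _, _ => 0
  | l :: P, s, t => ev1 l t + s * ev2 P s t

/-- The polynomial `l + e * m`. -/
noncomputable def addMul1 (e : ℕ) (l : List ℕ) : List ℕ → List ℕ :=
  List.rec (motive := fun _ => List ℕ → List ℕ)
    (fun m => List.rec (motive := fun _ => List ℕ) []
      (fun b _ ih => Nat.mul e b :: ih) m)
    (fun a l ih m => List.rec (motive := fun _ => List ℕ) (a :: l)
      (fun b m _ => Nat.add a (Nat.mul e b) :: ih m) m) l

/-- The polynomial `P + e * Q`. -/
noncomputable def addMul2 (e : ℕ) (P : List (List ℕ)) : List (List ℕ) → List (List ℕ) :=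
  List.rec (motive := fun _ => List (List ℕ) → List (List ℕ))
    (fun Q => List.rec (motive := fun _ => List (List ℕ)) []
      (fun m _ ih => addMul1 e [] m :: ih) Q)
    (fun l P ih Q => List.rec (motive := fun _ => List (List ℕ)) (l :: P)
      (fun m Q _ => addMul1 e l m :: ih Q) Q) P

/-- Coefficients of `p (t + e)`. -/
noncomputable def shift1 (e : ℕ) (l : List ℕ) : List ℕ :=
  List.rec (motive := fun _ => List ℕ) [] (fun a _ q => addMul1 e (a :: q) q) l

/-- Coefficients of `P (s + e, t)`. -/
noncomputable def shiftFst (e : ℕ) (P : List (List ℕ)) : List (List ℕ) :=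
  List.rec (motive := fun _ => List (List ℕ)) [] (fun l _ Q => addMul2 e (l :: Q) Q) P

/-- Coefficients of `P (s, t + e)`. -/
noncomputable def shiftSnd (e : ℕ) (P : List (List ℕ)) : List (List ℕ) :=
  List.rec (motive := fun _ => List (List ℕ)) [] (fun l _ Q => shift1 e l :: Q) P

/-- The sum of the positive coefficients of `m - l`, weighted by the powers of `r`. -/
noncomputable def deficit1 (r : ℕ) (l : List ℕ) : List ℕ → ℕ :=
  List.rec (motive := fun _ => List ℕ → ℕ)
    (fun m => List.rec (motive := fun _ => ℕ) 0 (fun b _ ih => Nat.add b (Nat.mul r ih)) m)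
    (fun a _ ih m => List.rec (motive := fun _ => ℕ) 0
      (fun b m _ => Nat.add (Nat.sub b a) (Nat.mul r (ih m))) m) l

/-- The sum of the positive coefficients of `Q - P`, weighted by the powers of `r` and `r'`. -/
noncomputable def deficit2 (r r' : ℕ) (P : List (List ℕ)) : List (List ℕ) → ℕ :=
  List.rec (motive := fun _ => List (List ℕ) → ℕ)
    (fun Q => List.rec (motive := fun _ => ℕ) 0
      (fun m _ ih => Nat.add (deficit1 r' [] m) (Nat.mul r ih)) Q)
    (fun l _ ih Q => List.rec (motive := fun _ => ℕ) 0
      (fun m Q _ => Nat.add (deficit1 r' l m) (Nat.mul r (ih Q))) Q) P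

noncomputable def const1 (l : List ℕ) : ℕ := List.rec (motive := fun _ => ℕ) 0 (fun a _ _ => a) l

noncomputable def const2 (P : List (List ℕ)) : ℕ :=
  List.rec (motive := fun _ => ℕ) 0 (fun l _ _ => const1 l) P

/-- Sufficient test for `Q < P` on `[0, r] × [0, r']`. -/
noncomputable def isLess (r r' : ℕ) (Q P : List (List ℕ)) : Bool :=
  Nat.blt (deficit2 r r' P Q) (Nat.sub (const2 P) (const2 Q))

/-- A bivariate integer polynomial as a difference of two polynomials over `ℕ`. -/
abbrev Poly := List (List ℕ) × List (List ℕ)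

noncomputable def Poly.isPos (r r' : ℕ) (P : Poly) : Bool := isLess r r' P.2 P.1
noncomputable def Poly.isNeg (r r' : ℕ) (P : Poly) : Bool := isLess r r' P.1 P.2
noncomputable def Poly.shiftFst (e : ℕ) (P : Poly) : Poly :=
  (HessianCurve.shiftFst e P.1, HessianCurve.shiftFst e P.2)
noncomputable def Poly.shiftSnd (e : ℕ) (P : Poly) : Poly :=
  (HessianCurve.shiftSnd e P.1, HessianCurve.shiftSnd e P.2)
def Poly.ev (P : Poly) (s t : ℝ) : ℝ := ev2 P.1 s t - ev2 P.2 s t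

/-- Tests by bisection that at each point of `[0, r] × [0, r']` one of the lists in `alts`
consists of polynomials that are positive there. -/
noncomputable def check (n : ℕ) : ℕ → ℕ → List (List Poly) → Bool :=
  Nat.rec (motive := fun _ => ℕ → ℕ → List (List Poly) → Bool) (fun _ _ _ => false)
    (fun _ ih r r' alts =>
      (fun live : List (List Poly) =>
        live.any (fun A => A.all (Poly.isPos r r')) ||
        bif Nat.ble r' r then
          ih (Nat.div r 2) r' live &&
          ih (Nat.sub r (Nat.div r 2)) r' (live.map (List.map (Poly.shiftFst (Nat.div r 2))))
        else
          ih r (Nat.div r' 2) live &&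
          ih r (Nat.sub r' (Nat.div r' 2)) (live.map (List.map (Poly.shiftSnd (Nat.div r' 2)))))
      (alts.filter fun A => !A.any (Poly.isNeg r r'))) n

/-! ### Trivariate polynomials -/

/-- A polynomial in `x`, `y`, `w` as a list of monomials `c * x ^ i * y ^ j * w ^ k`. -/
abbrev Form := List (ℤ × ℕ × ℕ × ℕ)

def Form.ev : Form → ℝ → ℝ → ℝ → ℝ
  | [], _, _, _ => 0
  | (c, i, j, k) :: M, x, y, w => c * x ^ i * y ^ j * w ^ k + Form.ev M x y w

def Form.smul (e : ℤ) (M : Form) : Form := M.map fun (c, i, j, k) => (e * c, i, j, k)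
def Form.mulX (M : Form) : Form := M.map fun (c, i, j, k) => (c, i + 1, j, k)
def Form.mulY (M : Form) : Form := M.map fun (c, i, j, k) => (c, i, j + 1, k)
def Form.mulW (M : Form) : Form := M.map fun (c, i, j, k) => (c, i, j, k + 1)

def Form.dX : Form → Form
  | [] => []
  | (_, 0, _, _) :: M => Form.dX M
  | (c, i + 1, j, k) :: M => (c * (i + 1), i, j, k) :: Form.dX M

def Form.dY : Form → Form
  | [] => []
  | (_, _, 0, _) :: M => Form.dY M
  | (c, i, j + 1, k) :: M => (c * (j + 1), i, j, k) :: Form.dY M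

/-- The linear form `a * x + b * y + c * w`. -/
def Form.lin (l : ℤ × ℤ × ℤ) : Form := [(l.1, 1, 0, 0), (l.2.1, 0, 1, 0), (l.2.2, 0, 0, 1)]

def Form.deg : Form → ℕ
  | [] => 0
  | (_, i, j, k) :: _ => i + j + k

def Form.isHom (M : Form) : Bool := M.all fun m => Nat.beq (m.2.1 + m.2.2.1 + m.2.2.2) M.deg

def mono1 (c : ℕ) : ℕ → List ℕ
  | 0 => [c]
  | j + 1 => 0 :: mono1 c j

def mono2 (c : ℕ) (j : ℕ) : ℕ → List (List ℕ)
  | 0 => [mono1 c j]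
  | i + 1 => [] :: mono2 c j i

/-- The bivariate polynomial with the given monomials `c * s ^ i * t ^ j`, negative coefficients
being replaced by zero. -/
noncomputable def dense : List (ℤ × ℕ × ℕ) → List (List ℕ)
  | [] => []
  | (c, i, j) :: L => addMul2 1 (mono2 c.toNat j i) (dense L)

noncomputable def toPoly (L : List (ℤ × ℕ × ℕ)) : Poly :=
  (dense L, dense (L.map fun (c, i, j) => (-c, i, j)))

/-- `M (s, t, S)`. -/
noncomputable def Form.chartW (S : ℕ) (M : Form) : Poly :=
  toPoly (M.map fun (c, i, j, k) => (c * (S ^ k : ℕ), i, j))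

/-- `M (S, t, s)`. -/
noncomputable def Form.chartX (S : ℕ) (M : Form) : Poly :=
  toPoly (M.map fun (c, i, j, k) => (c * (S ^ i : ℕ), k, j))

/-- `M (t, S, s)`. -/
noncomputable def Form.chartY (S : ℕ) (M : Form) : Poly :=
  toPoly (M.map fun (c, i, j, k) => (c * (S ^ j : ℕ), k, i))

/-- `M (-x, y, w)`. -/
def Form.negX (M : Form) : Form := M.map fun (c, i, j, k) => (c * (-1) ^ i, i, j, k)

/-- `M (x, -y, w)`. -/
def Form.negY (M : Form) : Form := M.map fun (c, i, j, k) => (c * (-1) ^ j, i, j, k)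

/-- Tests that at each point of the closed first quadrant one of the lists in `alts` consists of
forms that are positive there. -/
noncomputable def quadrant (alts : List (List Form)) : Bool :=
  alts.all (fun A => A.all Form.isHom) &&
  check 40 32768 32768 (alts.map (List.map (Form.chartW 4096))) &&
  check 40 8192 65536 (alts.map (List.map (Form.chartX 65536))) &&
  check 40 8192 65536 (alts.map (List.map (Form.chartY 65536)))

/-- Tests that at each point of the plane one of the lists in `alts` consists of forms that are
positive there. -/
noncomputable def everywhere (alts : List (List Form)) : Bool :=
  quadrant alts && quadrant (alts.map (List.map Form.negX)) &&
  quadrant (alts.map (List.map Form.negY)) &&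
  quadrant (alts.map (List.map fun M => M.negX.negY))

/-! ### The hessian form and the regions separating the components of its zero set -/

/-- The hessian determinant of `f`, homogenized to degree six. -/
def hess : Form :=
  [(-4993, 0, 0, 6), (26340, 0, 1, 5), (-71430, 0, 2, 4), (-86916, 0, 3, 3), (116239, 0, 4, 2),
   (36864, 0, 5, 1), (-39840, 0, 6, 0), (95020, 1, 0, 5), (272148, 1, 1, 4), (19440, 1, 2, 3),
   (-202048, 1, 3, 2), (81312, 1, 4, 1), (-55200, 1, 5, 0), (-142294, 2, 0, 4),
   (-529392, 2, 1, 3), (-174414, 2, 2, 2), (177696, 2, 3, 1), (209664, 2, 4, 0),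
   (-91628, 3, 0, 3), (-478640, 3, 1, 2), (-264432, 3, 2, 1), (550976, 3, 3, 0),
   (93375, 4, 0, 2), (259632, 4, 1, 1), (-410544, 4, 2, 0), (-10104, 5, 0, 1),
   (-331440, 5, 1, 0), (-74960, 6, 0, 0)]

/-- The open rectangle with the given bounds, in thousandths. -/
def box (a b c d : ℤ) : List (ℤ × ℤ × ℤ) :=
  [(1000, 0, -a), (-1000, 0, b), (0, 1000, -c), (0, -1000, d)]

/-- Seven bounded polygons and two unbounded ones, each given by affine inequalities. -/
def region : Fin 9 → List (ℤ × ℤ × ℤ) :=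
  ![box 90 330 1100 1377,
    box 560 1300 (-580) (-150),
    box (-50) 560 (-250) 900,
    box (-650) (-230) (-1100) (-600),
    box (-230) 1000 (-2500) (-600),
    box (-1700) 90 1300 3800 ++ [(50, 100, -91)],
    box (-7000) (-1000) 0 2500 ++ [(-50, -100, 91)],
    [(0, 1000, -1377), (100, -25, 5)],
    [(0, -1, -3)]]

/-- A point (in thousandths) inside each of the seven ovals. -/
def center : Fin 7 → ℤ × ℤ :=
  ![(205, 1280), (875, -375), (200, 260), (-400, -870), (350, -1160), (-870, 2130),
    (-3200, 1250)]

/-- A direction pointing into each of the two unbounded regions. -/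
def dir : Fin 2 → ℤ × ℤ := ![(13, 20), (-13, -20)]

/-- Inward derivative of the hessian along the rays from a point given in thousandths. -/
def radial (c : ℤ × ℤ) : Form :=
  (hess.dX.mulX.smul (-1000) ++ hess.dX.mulW.smul c.1) ++
  (hess.dY.mulY.smul (-1000) ++ hess.dY.mulW.smul c.2)

def directional (d : ℤ × ℤ) : Form := hess.dX.smul d.1 ++ hess.dY.smul d.2

def coverAlts : List (List Form) :=
  [hess.smul (-1)] :: (List.ofFn region).map (List.map Form.lin)

/-- Where the hessian vanishes and the inequalities in `L` hold, `G` is positive. -/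
def transversalAlts (L : List (ℤ × ℤ × ℤ)) (G : Form) : List (List Form) :=
  [hess] :: [hess.smul (-1)] :: [G] :: L.map fun l => [(Form.lin l).smul (-1)]

/-! ### Soundness of the subdivision test -/

theorem ev1_addMul1 (e : ℕ) (l m : List ℕ) (t : ℝ) :
    ev1 (addMul1 e l m) t = ev1 l t + e * ev1 m t := by
  induction l generalizing m with
  | nil =>
    induction m with
    | nil => change (0 : ℝ) = 0 + e * 0; ring
    | cons b m ih =>
      change ((e * b : ℕ) : ℝ) + t * ev1 (addMul1 e [] m) t = 0 + e * (b + t * ev1 m t)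
      rw [ih]; simp only [ev1]; push_cast; ring
  | cons a l ih =>
    cases m with
    | nil => change (a : ℝ) + t * ev1 l t = (a + t * ev1 l t) + e * 0; ring
    | cons b m =>
      change ((a + e * b : ℕ) : ℝ) + t * ev1 (addMul1 e l m) t =
        (a + t * ev1 l t) + e * (b + t * ev1 m t)
      rw [ih]; push_cast; ring

theorem ev2_addMul2 (e : ℕ) (P Q : List (List ℕ)) (s t : ℝ) :
    ev2 (addMul2 e P Q) s t = ev2 P s t + e * ev2 Q s t := by
  induction P generalizing Q with
  | nil =>
    induction Q with
    | nil => change (0 : ℝ) = 0 + e * 0; ring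
    | cons m Q ih =>
      change ev1 (addMul1 e [] m) t + s * ev2 (addMul2 e [] Q) s t =
        0 + e * (ev1 m t + s * ev2 Q s t)
      rw [ih, ev1_addMul1]; simp only [ev1, ev2]; ring
  | cons l P ih =>
    cases Q with
    | nil => change ev1 l t + s * ev2 P s t = (ev1 l t + s * ev2 P s t) + e * 0; ring
    | cons m Q =>
      change ev1 (addMul1 e l m) t + s * ev2 (addMul2 e P Q) s t =
        (ev1 l t + s * ev2 P s t) + e * (ev1 m t + s * ev2 Q s t)
      rw [ih, ev1_addMul1]; ring

theorem ev1_shift1 (e : ℕ) (l : List ℕ) (t : ℝ) : ev1 (shift1 e l) t = ev1 l (t + e) := by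
  induction l with
  | nil => rfl
  | cons a l ih =>
    change ev1 (addMul1 e (a :: shift1 e l) (shift1 e l)) t = a + (t + e) * ev1 l (t + e)
    rw [ev1_addMul1, ev1, ih]; ring

theorem ev2_shiftFst (e : ℕ) (P : List (List ℕ)) (s t : ℝ) :
    ev2 (shiftFst e P) s t = ev2 P (s + e) t := by
  induction P with
  | nil => rfl
  | cons l P ih =>
    change ev2 (addMul2 e (l :: shiftFst e P) (shiftFst e P)) s t =
      ev1 l t + (s + e) * ev2 P (s + e) t
    rw [ev2_addMul2, ev2, ih]; ring

theorem ev2_shiftSnd (e : ℕ) (P : List (List ℕ)) (s t : ℝ) :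
    ev2 (shiftSnd e P) s t = ev2 P s (t + e) := by
  induction P with
  | nil => rfl
  | cons l P ih =>
    change ev1 (shift1 e l) t + s * ev2 (shiftSnd e P) s t = ev1 l (t + e) + s * ev2 P s (t + e)
    rw [ev1_shift1, ih]

theorem ev1_nonneg (l : List ℕ) {t : ℝ} (ht : 0 ≤ t) : 0 ≤ ev1 l t := by
  induction l with
  | nil => exact le_rfl
  | cons a l ih => simp only [ev1]; positivity

theorem ev2_nonneg (P : List (List ℕ)) {s t : ℝ} (hs : 0 ≤ s) (ht : 0 ≤ t) : 0 ≤ ev2 P s t := by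
  induction P with
  | nil => exact le_rfl
  | cons l P ih => have := ev1_nonneg l ht; simp only [ev2]; positivity

theorem cast_add_tsub (a b : ℕ) : (b : ℝ) + (a - b : ℕ) = a + (b - a : ℕ) := by
  norm_cast; omega

theorem ev1_add_le {r : ℕ} {t : ℝ} (ht : 0 ≤ t) (htr : t ≤ r) (l m : List ℕ) :
    ev1 m t + (const1 l - const1 m : ℕ) ≤ ev1 l t + deficit1 r l m := by
  have key (u v : ℝ) (d : ℕ) (h : u ≤ v + d) : t * u ≤ t * v + r * d := by
    have := mul_le_mul_of_nonneg_left h ht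
    have := mul_le_mul_of_nonneg_right htr d.cast_nonneg
    linarith
  induction l generalizing m with
  | nil =>
    induction m with
    | nil => change (0 : ℝ) + (0 - 0 : ℕ) ≤ 0 + (0 : ℕ); simp
    | cons b m ih =>
      change (b + t * ev1 m t) + (0 - b : ℕ) ≤ 0 + ((b + r * deficit1 r [] m : ℕ) : ℝ)
      have := key (ev1 m t) 0 _ (le_trans (le_add_of_nonneg_right (Nat.cast_nonneg _)) ih)
      push_cast [Nat.zero_sub]
      linarith
  | cons a l ih =>
    cases m with
    | nil =>
      change (0 : ℝ) + (a - 0 : ℕ) ≤ (a + t * ev1 l t) + (0 : ℕ)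
      have := mul_nonneg ht (ev1_nonneg l ht)
      push_cast [Nat.sub_zero]
      linarith
    | cons b m =>
      change (b + t * ev1 m t) + (a - b : ℕ) ≤
        (a + t * ev1 l t) + ((b - a + r * deficit1 r l m : ℕ) : ℝ)
      have := key (ev1 m t) (ev1 l t) _
        (le_trans (le_add_of_nonneg_right (Nat.cast_nonneg _)) (ih m))
      have := cast_add_tsub a b
      push_cast at this ⊢
      linarith

theorem ev2_add_le {r r' : ℕ} {s t : ℝ} (hs : 0 ≤ s) (hsr : s ≤ r) (ht : 0 ≤ t) (htr : t ≤ r')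
    (P Q : List (List ℕ)) :
    ev2 Q s t + (const2 P - const2 Q : ℕ) ≤ ev2 P s t + deficit2 r r' P Q := by
  have key (u v : ℝ) (d : ℕ) (h : u ≤ v + d) : s * u ≤ s * v + r * d := by
    have := mul_le_mul_of_nonneg_left h hs
    have := mul_le_mul_of_nonneg_right hsr d.cast_nonneg
    linarith
  induction P generalizing Q with
  | nil =>
    induction Q with
    | nil => change (0 : ℝ) + (0 - 0 : ℕ) ≤ 0 + (0 : ℕ); simp
    | cons m Q ih =>
      change (ev1 m t + s * ev2 Q s t) + (0 - const1 m : ℕ) ≤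
        0 + ((deficit1 r' [] m + r * deficit2 r r' [] Q : ℕ) : ℝ)
      have := key (ev2 Q s t) 0 _ (le_trans (le_add_of_nonneg_right (Nat.cast_nonneg _)) ih)
      have := ev1_add_le ht htr [] m
      simp only [ev1, const1, Nat.zero_sub] at this
      push_cast [Nat.zero_sub] at this ⊢
      linarith
  | cons l P ih =>
    cases Q with
    | nil =>
      change (0 : ℝ) + (const1 l - 0 : ℕ) ≤ (ev1 l t + s * ev2 P s t) + (0 : ℕ)
      have := mul_nonneg hs (ev2_nonneg P hs ht)
      have := ev1_add_le ht htr l []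
      have h0 : deficit1 r' l [] = 0 := by cases l <;> rfl
      rw [h0] at this
      change (0 : ℝ) + (const1 l - 0 : ℕ) ≤ _ at this
      linarith
    | cons m Q =>
      change (ev1 m t + s * ev2 Q s t) + (const1 l - const1 m : ℕ) ≤
        (ev1 l t + s * ev2 P s t) + ((deficit1 r' l m + r * deficit2 r r' P Q : ℕ) : ℝ)
      have := key (ev2 Q s t) (ev2 P s t) _
        (le_trans (le_add_of_nonneg_right (Nat.cast_nonneg _)) (ih Q))
      have := ev1_add_le ht htr l m
      push_cast at this ⊢
      linarith

theorem ev2_lt_of_isLess {r r' : ℕ} {s t : ℝ} (hs : 0 ≤ s) (hsr : s ≤ r) (ht : 0 ≤ t)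
    (htr : t ≤ r') {P Q : List (List ℕ)} (h : isLess r r' Q P = true) :
    ev2 Q s t < ev2 P s t := by
  have h1 : deficit2 r r' P Q < const2 P - const2 Q := Nat.blt_eq ▸ h
  have h2 : (deficit2 r r' P Q : ℝ) < (const2 P - const2 Q : ℕ) := by exact_mod_cast h1
  have := ev2_add_le hs hsr ht htr P Q
  linarith

theorem Poly.ev_shiftFst (e : ℕ) (P : Poly) (s t : ℝ) :
    (P.shiftFst e).ev s t = P.ev (s + e) t := by
  simp only [Poly.ev, Poly.shiftFst, ev2_shiftFst]

theorem Poly.ev_shiftSnd (e : ℕ) (P : Poly) (s t : ℝ) :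
    (P.shiftSnd e).ev s t = P.ev s (t + e) := by
  simp only [Poly.ev, Poly.shiftSnd, ev2_shiftSnd]

theorem exists_alt_pos_of_check (n r r' : ℕ) (alts : List (List Poly))
    (h : check n r r' alts = true) {s t : ℝ} (hs : 0 ≤ s) (hsr : s ≤ r) (ht : 0 ≤ t)
    (htr : t ≤ r') : ∃ A ∈ alts, ∀ P ∈ A, 0 < P.ev s t := by
  induction n generalizing r r' alts s t with
  | zero => exact absurd h Bool.false_ne_true
  | succ n ih =>
    change (fun live : List (List Poly) =>
        live.any (fun A => A.all (Poly.isPos r r')) ||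
        bif Nat.ble r' r then
          check n (r / 2) r' live &&
          check n (r - r / 2) r' (live.map (List.map (Poly.shiftFst (r / 2))))
        else
          check n r (r' / 2) live &&
          check n r (r' - r' / 2) (live.map (List.map (Poly.shiftSnd (r' / 2)))))
      (alts.filter fun A => !A.any (Poly.isNeg r r')) = true at h
    suffices H : ∃ A ∈ alts.filter (fun A => !A.any (Poly.isNeg r r')), ∀ P ∈ A, 0 < P.ev s t by
      obtain ⟨A, hA, hpos⟩ := H
      exact ⟨A, (List.mem_filter.1 hA).1, hpos⟩
    generalize alts.filter (fun A => !A.any (Poly.isNeg r r')) = live at h ⊢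
    have half (a : ℕ) : ((a - a / 2 : ℕ) : ℝ) = a - (a / 2 : ℕ) :=
      Nat.cast_sub (Nat.div_le_self a 2)
    rcases Bool.or_eq_true_iff.1 h with h | h
    · obtain ⟨A, hA, hpos⟩ := List.any_eq_true.1 h
      refine ⟨A, hA, fun P hP => sub_pos.2 ?_⟩
      exact ev2_lt_of_isLess hs hsr ht htr (List.all_eq_true.1 hpos P hP)
    · cases hc : Nat.ble r' r <;> rw [hc] at h <;>
        simp only [cond_true, cond_false, Bool.and_eq_true] at h
      · rcases le_total t (r' / 2 : ℕ) with hle | hle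
        · exact ih _ _ _ h.1 hs hsr ht hle
        · obtain ⟨A, hA, hpos⟩ := ih _ _ _ h.2 hs hsr (sub_nonneg.2 hle)
            (by rw [half]; linarith)
          obtain ⟨B, hB, rfl⟩ := List.mem_map.1 hA
          refine ⟨B, hB, fun P hP => ?_⟩
          simpa [Poly.ev_shiftSnd] using hpos _ (List.mem_map_of_mem hP)
      · rcases le_total s (r / 2 : ℕ) with hle | hle
        · exact ih _ _ _ h.1 hs hle ht htr
        · obtain ⟨A, hA, hpos⟩ := ih _ _ _ h.2 (sub_nonneg.2 hle)
            (by rw [half]; linarith) ht htr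
          obtain ⟨B, hB, rfl⟩ := List.mem_map.1 hA
          refine ⟨B, hB, fun P hP => ?_⟩
          simpa [Poly.ev_shiftFst] using hpos _ (List.mem_map_of_mem hP)

/-! ### Positivity of forms on the plane -/

theorem ev1_mono1 (c j : ℕ) (t : ℝ) : ev1 (mono1 c j) t = c * t ^ j := by
  induction j with
  | zero => simp [mono1, ev1]
  | succ j ih => simp only [mono1, ev1, ih]; push_cast; ring

theorem ev2_mono2 (c j i : ℕ) (s t : ℝ) : ev2 (mono2 c j i) s t = c * s ^ i * t ^ j := by
  induction i with
  | zero => simp [mono2, ev2, ev1_mono1]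
  | succ i ih => simp only [mono2, ev2, ev1, ih]; ring

theorem ev_toPoly (L : List (ℤ × ℕ × ℕ)) (s t : ℝ) :
    (toPoly L).ev s t = (L.map fun m => (m.1 : ℝ) * s ^ m.2.1 * t ^ m.2.2).sum := by
  induction L with
  | nil => exact sub_self _
  | cons m L ih =>
    obtain ⟨c, i, j⟩ := m
    have hc : ((c.toNat : ℝ)) - (-c).toNat = c := by exact_mod_cast Int.toNat_sub_toNat_neg c
    simp only [toPoly, Poly.ev, dense, List.map_cons, List.sum_cons, ev2_addMul2,
      ev2_mono2] at ih ⊢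
    rw [← ih, ← hc]
    push_cast
    ring

namespace Form

theorem ev_eq_sum (M : Form) (x y w : ℝ) :
    M.ev x y w = (M.map fun m => (m.1 : ℝ) * x ^ m.2.1 * y ^ m.2.2.1 * w ^ m.2.2.2).sum := by
  induction M with
  | nil => rfl
  | cons m M ih => simp only [ev, List.map_cons, List.sum_cons, ih]

theorem ev_chartW (S : ℕ) (M : Form) (s t : ℝ) : (M.chartW S).ev s t = M.ev s t S := by
  rw [chartW, ev_toPoly, ev_eq_sum, List.map_map]
  congr 1
  refine List.map_congr_left fun m _ => ?_
  simp only [Function.comp]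
  push_cast
  ring

theorem ev_chartX (S : ℕ) (M : Form) (s t : ℝ) : (M.chartX S).ev s t = M.ev S t s := by
  rw [chartX, ev_toPoly, ev_eq_sum, List.map_map]
  congr 1
  refine List.map_congr_left fun m _ => ?_
  simp only [Function.comp]
  push_cast
  ring

theorem ev_chartY (S : ℕ) (M : Form) (s t : ℝ) : (M.chartY S).ev s t = M.ev t S s := by
  rw [chartY, ev_toPoly, ev_eq_sum, List.map_map]
  congr 1
  refine List.map_congr_left fun m _ => ?_
  simp only [Function.comp]
  push_cast
  ring

theorem ev_negX (M : Form) (x y w : ℝ) : M.negX.ev x y w = M.ev (-x) y w := by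
  rw [negX, ev_eq_sum, ev_eq_sum, List.map_map]
  congr 1
  refine List.map_congr_left fun m _ => ?_
  simp only [Function.comp, neg_pow x]
  push_cast
  ring

theorem ev_negY (M : Form) (x y w : ℝ) : M.negY.ev x y w = M.ev x (-y) w := by
  rw [negY, ev_eq_sum, ev_eq_sum, List.map_map]
  congr 1
  refine List.map_congr_left fun m _ => ?_
  simp only [Function.comp, neg_pow y]
  push_cast
  ring

theorem ev_mul_of_isHom {M : Form} (h : M.isHom = true) (r x y w : ℝ) :
    M.ev (r * x) (r * y) (r * w) = r ^ M.deg * M.ev x y w := by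
  rw [ev_eq_sum, ev_eq_sum, ← List.sum_map_mul_left]
  congr 1
  refine List.map_congr_left fun m hm => ?_
  rw [← Nat.eq_of_beq_eq_true (List.all_eq_true.1 h m hm)]
  ring

theorem ev_pos_of_isHom {M : Form} (h : M.isHom = true) {r x y w : ℝ} (hr : 0 < r)
    (hpos : 0 < M.ev (r * x) (r * y) (r * w)) : 0 < M.ev x y w := by
  rw [ev_mul_of_isHom h] at hpos
  exact (pos_iff_pos_of_mul_pos hpos).1 (pow_pos hr _)

end Form

theorem exists_alt_pos_of_check_map {n r r' : ℕ} {alts : List (List Form)} {g : Form → Poly}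
    (h : check n r r' (alts.map (List.map g)) = true) {s t : ℝ} (hs : 0 ≤ s) (hsr : s ≤ r)
    (ht : 0 ≤ t) (htr : t ≤ r') : ∃ A ∈ alts, ∀ M ∈ A, 0 < (g M).ev s t := by
  obtain ⟨B, hB, hpos⟩ := exists_alt_pos_of_check n r r' _ h hs hsr ht htr
  obtain ⟨A, hA, rfl⟩ := List.mem_map.1 hB
  exact ⟨A, hA, fun M hM => hpos _ (List.mem_map_of_mem hM)⟩

theorem exists_alt_pos_of_quadrant {alts : List (List Form)} (h : quadrant alts = true) {x y : ℝ}
    (hx : 0 ≤ x) (hy : 0 ≤ y) : ∃ A ∈ alts, ∀ M ∈ A, 0 < M.ev x y 1 := by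
  simp only [quadrant, Bool.and_eq_true, List.all_eq_true] at h
  obtain ⟨⟨⟨hom, hW⟩, hX⟩, hY⟩ := h
  have scale (r : ℝ) (hr : 0 < r) (H : ∃ A ∈ alts, ∀ M ∈ A, 0 < M.ev (r * x) (r * y) (r * 1)) :
      ∃ A ∈ alts, ∀ M ∈ A, 0 < M.ev x y 1 := by
    obtain ⟨A, hA, hpos⟩ := H
    exact ⟨A, hA, fun M hM => Form.ev_pos_of_isHom (hom A hA M hM) hr (hpos M hM)⟩
  by_cases hle : x ≤ 8 ∧ y ≤ 8
  · obtain ⟨A, hA, hpos⟩ := exists_alt_pos_of_check_map (s := 4096 * x) (t := 4096 * y) hW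
      (by positivity) (by push_cast; linarith) (by positivity) (by push_cast; linarith)
    refine scale 4096 (by norm_num) ⟨A, hA, fun M hM => ?_⟩
    simpa [Form.ev_chartW] using hpos M hM
  · have bound {a b : ℝ} (ha : 8 < a) (hb : 0 ≤ b) (hba : b ≤ a) :
        65536 / a ≤ (8192 : ℕ) ∧ 65536 / a * b ≤ (65536 : ℕ) ∧ 65536 / a * a = (65536 : ℕ) := by
      have ha0 : 0 < a := by linarith
      push_cast
      refine ⟨(div_le_iff₀ ha0).2 (by linarith), ?_, div_mul_cancel₀ _ ha0.ne'⟩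
      rw [div_mul_eq_mul_div, div_le_iff₀ ha0]
      linarith
    rcases le_total y x with hyx | hyx
    · have hx8 : 8 < x := by
        by_contra hcon
        exact hle ⟨by linarith, by linarith⟩
      obtain ⟨h1, h2, h3⟩ := bound hx8 hy hyx
      obtain ⟨A, hA, hpos⟩ := exists_alt_pos_of_check_map (s := 65536 / x) (t := 65536 / x * y) hX
        (by positivity) h1 (by positivity) h2
      refine scale (65536 / x) (by positivity) ⟨A, hA, fun M hM => ?_⟩
      rw [mul_one, h3, ← Form.ev_chartX]
      exact hpos M hM
    · have hy8 : 8 < y := by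
        by_contra hcon
        exact hle ⟨by linarith, by linarith⟩
      obtain ⟨h1, h2, h3⟩ := bound hy8 hx hyx
      obtain ⟨A, hA, hpos⟩ := exists_alt_pos_of_check_map (s := 65536 / y) (t := 65536 / y * x) hY
        (by positivity) h1 (by positivity) h2
      refine scale (65536 / y) (by positivity) ⟨A, hA, fun M hM => ?_⟩
      rw [mul_one, h3, ← Form.ev_chartY]
      exact hpos M hM

theorem exists_alt_pos_of_everywhere {alts : List (List Form)} (h : everywhere alts = true)
    (x y : ℝ) : ∃ A ∈ alts, ∀ M ∈ A, 0 < M.ev x y 1 := by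
  have transfer {g : Form → Form} {x' y' : ℝ} (hg : ∀ M, (g M).ev x' y' 1 = M.ev x y 1)
      (h' : quadrant (alts.map (List.map g)) = true) (hx' : 0 ≤ x') (hy' : 0 ≤ y') :
      ∃ A ∈ alts, ∀ M ∈ A, 0 < M.ev x y 1 := by
    obtain ⟨B, hB, hpos⟩ := exists_alt_pos_of_quadrant h' hx' hy'
    obtain ⟨A, hA, rfl⟩ := List.mem_map.1 hB
    exact ⟨A, hA, fun M hM => hg M ▸ hpos _ (List.mem_map_of_mem hM)⟩
  simp only [everywhere, Bool.and_eq_true] at h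
  obtain ⟨⟨⟨h1, h2⟩, h3⟩, h4⟩ := h
  rcases le_total 0 x with hx | hx <;> rcases le_total 0 y with hy | hy
  · exact exists_alt_pos_of_quadrant h1 hx hy
  · exact transfer (fun M => by rw [Form.ev_negY, neg_neg]) h3 hx (neg_nonneg.2 hy)
  · exact transfer (fun M => by rw [Form.ev_negX, neg_neg]) h2 (neg_nonneg.2 hx) hy
  · exact transfer (fun M => by rw [Form.ev_negY, Form.ev_negX, neg_neg, neg_neg]) h4
      (neg_nonneg.2 hx) (neg_nonneg.2 hy)

namespace Form

theorem ev_append (M N : Form) (x y w : ℝ) : Form.ev (M ++ N) x y w = M.ev x y w + N.ev x y w := by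
  simp only [ev_eq_sum, List.map_append, List.sum_append]

theorem ev_map {g : ℤ × ℕ × ℕ × ℕ → ℤ × ℕ × ℕ × ℕ} {r x y w : ℝ}
    (hg : ∀ m, ((g m).1 : ℝ) * x ^ (g m).2.1 * y ^ (g m).2.2.1 * w ^ (g m).2.2.2 =
      r * (m.1 * x ^ m.2.1 * y ^ m.2.2.1 * w ^ m.2.2.2)) (M : Form) :
    Form.ev (M.map g) x y w = r * M.ev x y w := by
  rw [ev_eq_sum, ev_eq_sum, List.map_map, ← List.sum_map_mul_left]
  exact congrArg _ (List.map_congr_left fun m _ => hg m)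

theorem ev_smul (e : ℤ) (M : Form) (x y w : ℝ) : (M.smul e).ev x y w = e * M.ev x y w :=
  ev_map (fun m => by push_cast; ring) M

theorem ev_mulX (M : Form) (x y w : ℝ) : M.mulX.ev x y w = x * M.ev x y w :=
  ev_map (fun m => by ring) M

theorem ev_mulY (M : Form) (x y w : ℝ) : M.mulY.ev x y w = y * M.ev x y w :=
  ev_map (fun m => by ring) M

theorem ev_mulW (M : Form) (x y w : ℝ) : M.mulW.ev x y w = w * M.ev x y w :=
  ev_map (fun m => by ring) M

theorem ev_lin (l : ℤ × ℤ × ℤ) (x y w : ℝ) :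
    (Form.lin l).ev x y w = l.1 * x + l.2.1 * y + l.2.2 * w := by
  simp only [lin, ev]; ring

theorem ev_dX_cons (m : ℤ × ℕ × ℕ × ℕ) (M : Form) (x y w : ℝ) :
    (dX (m :: M)).ev x y w =
      m.1 * (m.2.1 * x ^ (m.2.1 - 1)) * y ^ m.2.2.1 * w ^ m.2.2.2 + M.dX.ev x y w := by
  obtain ⟨c, i, j, k⟩ := m
  cases i with
  | zero => simp [dX]
  | succ i => simp only [dX, ev, Nat.add_sub_cancel]; push_cast; ring

theorem ev_dY_cons (m : ℤ × ℕ × ℕ × ℕ) (M : Form) (x y w : ℝ) :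
    (dY (m :: M)).ev x y w =
      m.1 * x ^ m.2.1 * (m.2.2.1 * y ^ (m.2.2.1 - 1)) * w ^ m.2.2.2 + M.dY.ev x y w := by
  obtain ⟨c, i, j, k⟩ := m
  cases j with
  | zero => simp [dY]
  | succ j => simp only [dY, ev, Nat.add_sub_cancel]; push_cast; ring

theorem hasDerivAt_ev (M : Form) {u v : ℝ → ℝ} {u' v' t : ℝ} (hu : HasDerivAt u u' t)
    (hv : HasDerivAt v v' t) (w : ℝ) :
    HasDerivAt (fun t => M.ev (u t) (v t) w)
      (u' * M.dX.ev (u t) (v t) w + v' * M.dY.ev (u t) (v t) w) t := by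
  induction M with
  | nil => simpa [ev, dX, dY] using hasDerivAt_const t (0 : ℝ)
  | cons m M ih =>
    have := ((((hu.pow m.2.1).const_mul (m.1 : ℝ)).mul (hv.pow m.2.2.1)).mul_const
      (w ^ m.2.2.2)).add ih
    rw [ev_dX_cons, ev_dY_cons]
    refine this.congr_deriv ?_
    simp only [Pi.pow_apply]
    ring

theorem continuous_ev (M : Form) : Continuous fun p : ℝ × ℝ × ℝ => M.ev p.1 p.2.1 p.2.2 := by
  induction M with
  | nil => exact continuous_const
  | cons m M ih => simp only [ev]; fun_prop

theorem continuous_ev_one (M : Form) : Continuous fun p : ℝ × ℝ => M.ev p.1 p.2 1 :=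
  M.continuous_ev.comp (by fun_prop : Continuous fun p : ℝ × ℝ => (p.1, p.2, (1 : ℝ)))

theorem hasDerivAt_ev_line (M : Form) (p v : ℝ × ℝ) (t : ℝ) :
    HasDerivAt (fun t : ℝ => M.ev (p + t • v).1 (p + t • v).2 1)
      (v.1 * M.dX.ev (p + t • v).1 (p + t • v).2 1 +
        v.2 * M.dY.ev (p + t • v).1 (p + t • v).2 1) t := by
  have h1 : HasDerivAt (fun t : ℝ => p.1 + t * v.1) v.1 t := by
    simpa using ((hasDerivAt_id t).mul_const v.1).const_add p.1
  have h2 : HasDerivAt (fun t : ℝ => p.2 + t * v.2) v.2 t := by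
    simpa using ((hasDerivAt_id t).mul_const v.2).const_add p.2
  exact M.hasDerivAt_ev h1 h2 1

end Form

/-! ### Certificates -/

theorem everywhere_cover : everywhere coverAlts = true := by decide +kernel

set_option maxHeartbeats 40000000 in
theorem everywhere_radial (i : Fin 7) :
    everywhere (transversalAlts (region (i.castAdd 2)) (radial (center i))) = true := by
  fin_cases i <;> decide +kernel

set_option maxHeartbeats 40000000 in
theorem everywhere_directional (j : Fin 2) :
    everywhere (transversalAlts (region (j.natAdd 7)) (directional (dir j))) = true := by
  fin_cases j <;> decide +kernel

/-! ### The hessian of `f` -/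

/-- The hessian determinant of `f` as a function. -/
def hessFn (p : ℝ × ℝ) : ℝ := hess.ev p.1 p.2 1

theorem continuous_hessFn : Continuous hessFn :=
  hess.continuous_ev_one

theorem pderiv_ofNat (n : ℕ) [n.AtLeastTwo] (i : Fin 2) :
    pderiv i (no_index (OfNat.ofNat n : MvPolynomial (Fin 2) ℝ)) = 0 :=
  (pderiv i).map_natCast n

theorem pderiv_zero_f : pderiv 0 f = -103 * X 1 - 52 * X 0 + 45 * X 1 ^ 2 + 182 * X 0 * X 1
    - 288 * X 0 ^ 2 + 43 * X 1 ^ 3 + 12 * X 0 * X 1 ^ 2 + 33 * X 0 ^ 2 * X 1 + 196 * X 0 ^ 3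
    - 20 * X 1 ^ 4 - 76 * X 0 * X 1 ^ 3 - 42 * X 0 ^ 2 * X 1 ^ 2 + 180 * X 0 ^ 3 * X 1
    + 380 * X 0 ^ 4 := by
  simp [f, pderiv_X, Derivation.leibniz, Derivation.leibniz_pow, pderiv_ofNat]
  ring

theorem pderiv_one_f : pderiv 1 f = -108 * X 1 - 103 * X 0 - 264 * X 1 ^ 2 + 90 * X 0 * X 1
    + 91 * X 0 ^ 2 - 48 * X 1 ^ 3 + 129 * X 0 * X 1 ^ 2 + 12 * X 0 ^ 2 * X 1 + 11 * X 0 ^ 3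
    + 110 * X 1 ^ 4 - 80 * X 0 * X 1 ^ 3 - 114 * X 0 ^ 2 * X 1 ^ 2 - 28 * X 0 ^ 3 * X 1
    + 45 * X 0 ^ 4 := by
  simp [f, pderiv_X, Derivation.leibniz, Derivation.leibniz_pow, pderiv_ofNat]
  ring

set_option maxRecDepth 20000 in
theorem eval_hess_f (x y : ℝ) : eval ![x, y] (Hess f) = hessFn (x, y) := by
  simp [Hess, pderiv_zero_f, pderiv_one_f, pderiv_X, Derivation.leibniz, Derivation.leibniz_pow,
    pderiv_ofNat]
  simp [hessFn, hess, Form.ev]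
  ring

theorem Z_eq : Z = {p | hessFn p = 0} :=
  Set.ext fun p => by rw [Z, Set.mem_ofPred_eq, Set.mem_ofPred_eq, eval_hess_f]

/-! ### The separating polygons -/

/-- The open convex polygon given by the inequalities in `region i`. -/
def U (i : Fin 9) : Set (ℝ × ℝ) := {p | ∀ l ∈ region i, 0 < l.1 * p.1 + l.2.1 * p.2 + l.2.2}

theorem isOpen_U (i : Fin 9) : IsOpen (U i) := by
  have : U i = ⋂ l ∈ {l | l ∈ region i},
      {p : ℝ × ℝ | 0 < (l.1 : ℝ) * p.1 + l.2.1 * p.2 + l.2.2} := by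
    ext p; simp [U]
  rw [this]
  exact (List.finite_toSet _).isOpen_biInter fun l _ => isOpen_lt (by fun_prop) (by fun_prop)

theorem convex_U (i : Fin 9) : Convex ℝ (U i) := by
  intro p hp q hq a b ha hb hab l hl
  have h1 := hp l hl
  have h2 := hq l hl
  have : (l.1 : ℝ) * (a • p + b • q).1 + l.2.1 * (a • p + b • q).2 + l.2.2 =
      a * (l.1 * p.1 + l.2.1 * p.2 + l.2.2) + b * (l.1 * q.1 + l.2.1 * q.2 + l.2.2) := by
    simp only [Prod.fst_add, Prod.snd_add, Prod.smul_fst, Prod.smul_snd, smul_eq_mul]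
    linear_combination (-(l.2.2 : ℝ)) * hab
  rw [this]
  rcases ha.eq_or_lt with rfl | ha
  · rw [show b = 1 by linarith]; linarith
  · positivity

theorem pairwise_disjoint_U : Pairwise fun i j => Disjoint (U i) (U j) := by
  intro i j hij
  wlog hlt : i < j generalizing i j
  · exact (this hij.symm (hij.lt_or_gt.resolve_left hlt)).symm
  rw [Set.disjoint_left]
  intro p hi hj
  fin_cases i <;> fin_cases j <;> first
    | exact absurd hlt (by decide)
    | simp [U, region, box] at hi hj; linarith

theorem abs_le_of_mem_U {i : Fin 7} {p : ℝ × ℝ} (hp : p ∈ U (i.castAdd 2)) :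
    |p.1| ≤ 10 ∧ |p.2| ≤ 10 := by
  simp only [abs_le]
  fin_cases i <;> simp [U, region, box] at hp <;> refine ⟨⟨?_, ?_⟩, ?_, ?_⟩ <;> linarith

/-- The point `center i` in the plane. -/
noncomputable def centerPt (i : Fin 7) : ℝ × ℝ := ((center i).1 / 1000, (center i).2 / 1000)

theorem centerPt_mem_U (i : Fin 7) : centerPt i ∈ U (i.castAdd 2) := by
  fin_cases i <;> simp [U, region, box, centerPt, center] <;> norm_num

theorem hessFn_centerPt_pos (i : Fin 7) : 0 < hessFn (centerPt i) := by
  fin_cases i <;> simp [hessFn, hess, Form.ev, centerPt, center] <;> norm_num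

theorem hessFn_neg_or_mem_U (p : ℝ × ℝ) : hessFn p < 0 ∨ ∃ i, p ∈ U i := by
  obtain ⟨A, hA, hpos⟩ := exists_alt_pos_of_everywhere everywhere_cover p.1 p.2
  rcases List.mem_cons.1 hA with rfl | hA
  · left
    have := hpos _ (List.mem_singleton_self _)
    rw [Form.ev_smul] at this
    push_cast at this
    rw [hessFn]
    linarith
  · right
    obtain ⟨L, hL, rfl⟩ := List.mem_map.1 hA
    obtain ⟨i, rfl⟩ := (List.mem_ofFn' _ _).1 hL
    refine ⟨i, fun l hl => ?_⟩
    have := hpos _ (List.mem_map_of_mem hl)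
    rwa [Form.ev_lin, mul_one] at this

theorem ev_pos_of_transversal {i : Fin 9} {G : Form}
    (hG : everywhere (transversalAlts (region i) G) = true) {p : ℝ × ℝ} (hp : p ∈ U i)
    (h0 : hessFn p = 0) : 0 < G.ev p.1 p.2 1 := by
  obtain ⟨A, hA, hpos⟩ := exists_alt_pos_of_everywhere hG p.1 p.2
  rw [hessFn] at h0
  simp only [transversalAlts, List.mem_cons] at hA
  rcases hA with rfl | rfl | rfl | hA
  · exact absurd (hpos _ (List.mem_singleton_self _)) h0.not_gt
  · have := hpos _ (List.mem_singleton_self _)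
    rw [Form.ev_smul, h0, mul_zero] at this
    exact absurd this (lt_irrefl _)
  · exact hpos _ (List.mem_singleton_self _)
  · obtain ⟨l, hl, rfl⟩ := List.mem_map.1 hA
    have := hpos _ (List.mem_singleton_self _)
    rw [Form.ev_smul, Form.ev_lin] at this
    have := hp l hl
    push_cast at *
    linarith

/-- The derivative of `hessFn` along a line. -/
noncomputable def dirDeriv (p v : ℝ × ℝ) : ℝ :=
  v.1 * hess.dX.ev p.1 p.2 1 + v.2 * hess.dY.ev p.1 p.2 1

theorem hasDerivAt_hessFn (p v : ℝ × ℝ) (t : ℝ) :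
    HasDerivAt (fun t : ℝ => hessFn (p + t • v)) (dirDeriv (p + t • v) v) t :=
  hess.hasDerivAt_ev_line p v t

theorem dirDeriv_neg_of_ray (i : Fin 7) {v : ℝ × ℝ} {t : ℝ} (ht : 0 < t)
    (hp : centerPt i + t • v ∈ U (i.castAdd 2)) (h0 : hessFn (centerPt i + t • v) = 0) :
    dirDeriv (centerPt i + t • v) v < 0 := by
  have := ev_pos_of_transversal (everywhere_radial i) hp h0
  have h1 : (centerPt i + t • v).1 * 1000 = (center i).1 + t * v.1 * 1000 := by
    simp [centerPt]; ring
  have h2 : (centerPt i + t • v).2 * 1000 = (center i).2 + t * v.2 * 1000 := by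
    simp [centerPt]; ring
  simp only [radial, Form.ev_append, Form.ev_smul, Form.ev_mulX, Form.ev_mulY, Form.ev_mulW] at this
  rw [dirDeriv]
  generalize centerPt i + t • v = q at *
  have : 0 < -(t * 1000) *
      (v.1 * hess.dX.ev q.1 q.2 1 + v.2 * hess.dY.ev q.1 q.2 1) := by
    push_cast at this
    linear_combination this - hess.dX.ev q.1 q.2 1 * h1 - hess.dY.ev q.1 q.2 1 * h2
  nlinarith

/-- The direction `dir j` as a vector. -/
def dirVec (j : Fin 2) : ℝ × ℝ := ((dir j).1, (dir j).2)

theorem dirDeriv_pos_of_wedge (j : Fin 2) {p : ℝ × ℝ} (hp : p ∈ U (j.natAdd 7))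
    (h0 : hessFn p = 0) : 0 < dirDeriv p (dirVec j) := by
  have := ev_pos_of_transversal (everywhere_directional j) hp h0
  rwa [directional, Form.ev_append, Form.ev_smul, Form.ev_smul] at this

/-! ### Connectedness of zero sets that are graphs -/

/-- If `φ` is increasing at each of its zeros, then it is positive after a point where it is
nonnegative. -/
theorem pos_of_deriv_pos_of_zero {φ φ' : ℝ → ℝ} {s : Set ℝ} (hs : s.OrdConnected)
    (hd : ∀ t ∈ s, HasDerivAt φ (φ' t) t) (hpos : ∀ t ∈ s, φ t = 0 → 0 < φ' t) {a b : ℝ}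
    (ha : a ∈ s) (hb : b ∈ s) (hab : a < b) (h0 : 0 ≤ φ a) : 0 < φ b := by
  have hsub := hs.out ha hb
  have hnonneg : ∀ ⦃t⦄, t ∈ Set.Icc a b → 0 ≤ φ t :=
    image_le_of_deriv_right_lt_deriv_boundary' (f := fun _ => 0) (f' := fun _ => 0)
      continuousOn_const (fun t _ => hasDerivWithinAt_const _ _ _) h0
      (fun t ht => (hd t (hsub ht)).continuousAt.continuousWithinAt)
      (fun t ht => (hd t (hsub (Set.Ico_subset_Icc_self ht))).hasDerivWithinAt)
      (fun t ht h0 => hpos t (hsub (Set.Ico_subset_Icc_self ht)) h0.symm)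
  refine (hnonneg (Set.right_mem_Icc.2 hab.le)).lt_of_ne fun hzero => ?_
  have hslope := ((hasDerivAt_iff_tendsto_slope.1 (hd b hb)).mono_left
    (nhdsWithin_mono b (show Set.Iio b ⊆ {b}ᶜ from fun t ht => ne_of_lt ht))).eventually
      (lt_mem_nhds (hpos b hb hzero.symm))
  obtain ⟨t, ht, htab⟩ := (hslope.and (Ioo_mem_nhdsLT hab)).exists
  rw [slope_def_field, ← hzero, sub_zero, div_pos_iff] at ht
  have := hnonneg ⟨htab.1.le, htab.2.le⟩
  rcases ht with ht | ht
  · linarith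
  · linarith [htab.2]

/-- The zero set of `φ` in `Ω` is connected if it is a graph over the first coordinate. -/
theorem isPreconnected_zeros {Ω : Set (ℝ × ℝ)} {φ φ' : ℝ × ℝ → ℝ} (hΩ : IsOpen Ω)
    (hfib : ∀ s, {t | (s, t) ∈ Ω}.OrdConnected) (hφ : Continuous φ)
    (hd : ∀ s t, HasDerivAt (fun t => φ (s, t)) (φ' (s, t)) t)
    (hpos : ∀ q ∈ Ω, φ q = 0 → 0 < φ' q) (hex : ∀ s, ∃ t, (s, t) ∈ Ω ∧ φ (s, t) = 0) :
    IsPreconnected {q ∈ Ω | φ q = 0} := by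
  choose τ hτ using hex
  have key (s a b : ℝ) (ha : (s, a) ∈ Ω) (hb : (s, b) ∈ Ω) (hab : a < b) (h0 : 0 ≤ φ (s, a)) :
      0 < φ (s, b) :=
    pos_of_deriv_pos_of_zero (hfib s) (fun t _ => hd s t) (fun t ht => hpos (s, t) ht) ha hb hab h0
  have hcont : Continuous τ := by
    refine continuous_iff_continuousAt.2 fun s => tendsto_order.2 ⟨fun a ha => ?_, fun b hb => ?_⟩
    · obtain ⟨t, ht, hat⟩ := (((((Continuous.prodMk_right s).tendsto (τ s)).eventually
        (hΩ.mem_nhds (hτ s).1)).filter_mono nhdsWithin_le_nhds).and (Ioo_mem_nhdsLT ha)).exists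
      have hneg : φ (s, t) < 0 := by
        by_contra! hcon
        exact (key s t (τ s) ht (hτ s).1 hat.2 hcon).ne' (hτ s).2
      have hlt : ∀ᶠ s' in nhds s, φ (s', t) < 0 :=
        (hφ.comp (Continuous.prodMk_left t)).continuousAt.eventually_lt_const hneg
      filter_upwards [hlt, ((Continuous.prodMk_left t).tendsto s).eventually (hΩ.mem_nhds ht)]
        with s' h1 h2
      refine hat.1.trans ?_
      by_contra! hcon
      rcases hcon.eq_or_lt with heq | hlt
      · exact h1.ne (heq ▸ (hτ s').2)
      · exact h1.not_gt (key s' _ _ (hτ s').1 h2 hlt (hτ s').2.ge)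
    · obtain ⟨t, ht, hbt⟩ := (((((Continuous.prodMk_right s).tendsto (τ s)).eventually
        (hΩ.mem_nhds (hτ s).1)).filter_mono nhdsWithin_le_nhds).and (Ioo_mem_nhdsGT hb)).exists
      have hp : 0 < φ (s, t) := key s (τ s) t (hτ s).1 ht hbt.1 (hτ s).2.ge
      have hgt : ∀ᶠ s' in nhds s, 0 < φ (s', t) :=
        (hφ.comp (Continuous.prodMk_left t)).continuousAt.eventually_const_lt hp
      filter_upwards [hgt, ((Continuous.prodMk_left t).tendsto s).eventually (hΩ.mem_nhds ht)]
        with s' h1 h2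
      refine lt_trans ?_ hbt.2
      by_contra! hcon
      rcases hcon.eq_or_lt with heq | hlt
      · exact h1.ne' (heq ▸ (hτ s').2)
      · exact (key s' _ _ h2 (hτ s').1 hlt h1.le).ne' (hτ s').2
  have huniq (s t : ℝ) (ht : (s, t) ∈ Ω) (h0 : φ (s, t) = 0) : t = τ s := by
    rcases lt_trichotomy t (τ s) with hlt | heq | hlt
    · exact absurd (hτ s).2 (key s _ _ ht (hτ s).1 hlt h0.ge).ne'
    · exact heq
    · exact absurd h0 (key s _ _ (hτ s).1 ht hlt (hτ s).2.ge).ne'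
  have : {q ∈ Ω | φ q = 0} = Set.range fun s => (s, τ s) := by
    ext ⟨s, t⟩
    constructor
    · rintro ⟨h1, h2⟩
      exact ⟨s, by rw [huniq s t h1 h2]⟩
    · rintro ⟨s', hs'⟩
      rw [← hs']
      exact hτ s'
  rw [this]
  exact isPreconnected_range (by fun_prop)

/-! ### The pieces of the hessian curve -/

/-- The part of the hessian curve in the polygon `U i`. -/
def piece (i : Fin 9) : Set (ℝ × ℝ) := {p ∈ U i | hessFn p = 0}

theorem exists_mem_piece {i : Fin 9} {L : Set (ℝ × ℝ)} (hL : IsPreconnected L) {p q : ℝ × ℝ}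
    (hp : p ∈ L) (hpU : p ∈ U i) (hp0 : 0 < hessFn p) (hq : q ∈ L) (hqU : q ∉ U i) :
    ∃ z ∈ L, z ∈ piece i := by
  by_contra! hcon
  have hcover (z : ℝ × ℝ) (hz : z ∉ U i ∩ {z | 0 < hessFn z}) (hzL : z ∈ L) :
      z ∈ (⋃ j ∈ {j | j ≠ i}, U j) ∪ {z | hessFn z < 0} := by
    rcases hessFn_neg_or_mem_U z with hneg | ⟨j, hj⟩
    · exact Or.inr hneg
    · by_cases hji : j = i
      · subst hji
        exact Or.inr (lt_of_le_of_ne (not_lt.1 fun h0 => hz ⟨hj, h0⟩) fun h0 => hcon z hzL ⟨hj, h0⟩)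
      · exact Or.inl (Set.mem_biUnion hji hj)
  obtain ⟨z, -, ⟨hzU, hz0⟩, hz⟩ := hL (U i ∩ {z | 0 < hessFn z})
    ((⋃ j ∈ {j | j ≠ i}, U j) ∪ {z | hessFn z < 0})
    ((isOpen_U i).inter (isOpen_lt continuous_const continuous_hessFn))
    ((isOpen_biUnion fun j _ => isOpen_U j).union (isOpen_lt continuous_hessFn continuous_const))
    (fun z hz => or_iff_not_imp_left.2 fun hn => hcover z hn hz)
    ⟨p, hp, hpU, hp0⟩ ⟨q, hq, hcover q (fun hn => hqU hn.1) hq⟩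
  rcases hz with hz | hz
  · obtain ⟨j, hji, hj⟩ := Set.mem_iUnion₂.1 hz
    exact Set.disjoint_left.1 (pairwise_disjoint_U hji) hj hzU
  · exact lt_asymm (show hessFn z < 0 from hz) hz0

theorem ordConnected_line (i : Fin 9) (p v : ℝ × ℝ) : {t : ℝ | p + t • v ∈ U i}.OrdConnected := by
  refine Convex.ordConnected fun a ha b hb x y hx hy hxy => ?_
  have := convex_U i ha hb hx hy hxy
  change p + (x • a + y • b) • v ∈ U i
  convert this using 1
  rw [smul_add, smul_add, add_add_add_comm, ← add_smul, hxy, one_smul, smul_smul, smul_smul,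
    ← add_smul, smul_eq_mul, smul_eq_mul]

theorem isPreconnected_ray (p v : ℝ × ℝ) {s : Set ℝ} (hs : IsPreconnected s) :
    IsPreconnected ((fun t : ℝ => p + t • v) '' s) :=
  hs.image _ (by fun_prop)

theorem exists_mem_piece_ray (i : Fin 7) (θ : ℝ) :
    ∃ t : ℝ, 0 < t ∧ centerPt i + t • (Real.cos θ, Real.sin θ) ∈ piece (i.castAdd 2) := by
  obtain ⟨z, ⟨t, ht, rfl⟩, hz⟩ := exists_mem_piece
    (isPreconnected_ray (centerPt i) (Real.cos θ, Real.sin θ) (isPreconnected_Ici (a := (0 : ℝ))))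
    ⟨0, Set.self_mem_Ici, by simp⟩ (centerPt_mem_U i) (hessFn_centerPt_pos i) ⟨100, by simp, rfl⟩
    (fun hU => by
      have h1 := abs_le_of_mem_U hU
      have h2 := abs_le_of_mem_U (centerPt_mem_U i)
      simp only [abs_le, Prod.fst_add, Prod.snd_add, Prod.smul_fst, Prod.smul_snd,
        smul_eq_mul] at h1 h2
      nlinarith [Real.sin_sq_add_cos_sq θ])
  refine ⟨t, lt_of_le_of_ne ht ?_, hz⟩
  rintro rfl
  have := hz.2
  simp only [zero_smul, add_zero] at this
  exact (hessFn_centerPt_pos i).ne' this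

theorem isPreconnected_piece_castAdd (i : Fin 7) : IsPreconnected (piece (i.castAdd 2)) := by
  let e : ℝ × ℝ → ℝ × ℝ := fun q => centerPt i + q.2 • (Real.cos q.1, Real.sin q.1)
  have he : Continuous e := by fun_prop
  have hpre : IsPreconnected
      {q ∈ {q : ℝ × ℝ | 0 < q.2 ∧ e q ∈ U (i.castAdd 2)} | -hessFn (e q) = 0} := by
    refine isPreconnected_zeros (φ' := fun q => -dirDeriv (e q) (Real.cos q.1, Real.sin q.1))
      ((isOpen_lt continuous_const continuous_snd).inter ((isOpen_U _).preimage he))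
      (fun s => Set.OrdConnected.inter (s := Set.Ioi 0)
        (t := {t | centerPt i + t • (Real.cos s, Real.sin s) ∈ U (i.castAdd 2)})
        Set.ordConnected_Ioi (ordConnected_line _ _ _)) (continuous_hessFn.comp he).neg
      (fun s t => (hasDerivAt_hessFn (centerPt i) (Real.cos s, Real.sin s) t).neg)
      (fun q hq h0 => neg_pos.2 (dirDeriv_neg_of_ray i hq.1 hq.2 (neg_eq_zero.1 h0))) fun s => ?_
    obtain ⟨t, ht, hU, h0⟩ := exists_mem_piece_ray i s
    exact ⟨t, ⟨ht, hU⟩, neg_eq_zero.2 h0⟩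
  convert hpre.image e he.continuousOn
  ext z
  constructor
  · rintro ⟨hU, h0⟩
    let w : ℂ := ⟨(z - centerPt i).1, (z - centerPt i).2⟩
    have hez : e (w.arg, ‖w‖) = z := by
      ext <;> simp [e, w]
    refine ⟨(w.arg, ‖w‖), ⟨⟨norm_pos_iff.2 fun hw => ?_, hez.symm ▸ hU⟩, by rw [hez, h0, neg_zero]⟩,
      hez⟩
    have : z = centerPt i := by rw [← hez, hw]; simp [e]
    exact (hessFn_centerPt_pos i).ne' (this ▸ h0)
  · rintro ⟨q, ⟨hq, h0⟩, rfl⟩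
    exact ⟨hq.2, neg_eq_zero.1 h0⟩

theorem isHom_hess : hess.isHom = true := by decide +kernel

theorem hess_ev_dirVec_pos (j : Fin 2) : 0 < hess.ev (dirVec j).1 (dirVec j).2 0 := by
  fin_cases j <;> simp [hess, Form.ev, dirVec, dir] <;> norm_num

theorem eventually_hessFn_pos (j : Fin 2) (p : ℝ × ℝ) :
    ∀ᶠ t : ℝ in Filter.atTop, 0 < hessFn (p + t • dirVec j) := by
  have hlim : Filter.Tendsto
      (fun t : ℝ => hess.ev (t⁻¹ * p.1 + (dirVec j).1) (t⁻¹ * p.2 + (dirVec j).2) t⁻¹)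
      Filter.atTop (nhds (hess.ev (0 * p.1 + (dirVec j).1) (0 * p.2 + (dirVec j).2) 0)) :=
    ((hess.continuous_ev.comp (by fun_prop : Continuous fun r : ℝ =>
      (r * p.1 + (dirVec j).1, r * p.2 + (dirVec j).2, r))).tendsto 0).comp
        tendsto_inv_atTop_zero
  rw [zero_mul, zero_mul, zero_add, zero_add] at hlim
  filter_upwards [hlim.eventually (lt_mem_nhds (hess_ev_dirVec_pos j)),
    Filter.eventually_gt_atTop 0]
    with t ht ht0
  refine Form.ev_pos_of_isHom isHom_hess (inv_pos.2 ht0) ?_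
  have h1 : t⁻¹ * (p + t • dirVec j).1 = t⁻¹ * p.1 + (dirVec j).1 := by simp; field_simp
  have h2 : t⁻¹ * (p + t • dirVec j).2 = t⁻¹ * p.2 + (dirVec j).2 := by simp; field_simp
  rwa [h1, h2, mul_one]

theorem exists_mem_piece_line (j : Fin 2) (s : ℝ) :
    ∃ t : ℝ, (s, 0) + t • dirVec j ∈ piece (j.natAdd 7) := by
  obtain ⟨t, ht, hst⟩ := ((eventually_hessFn_pos j (s, 0)).and
    (Filter.eventually_ge_atTop (|s| + 1))).exists
  have h1 := neg_abs_le s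
  have h2 := le_abs_self s
  obtain ⟨z, ⟨t, -, rfl⟩, hz⟩ := exists_mem_piece (i := j.natAdd 7)
    (isPreconnected_ray (s, 0) (dirVec j) isPreconnected_univ) ⟨t, trivial, rfl⟩
    (by fin_cases j <;> simp [U, region, dirVec, dir] <;> (try constructor) <;> linarith) ht
    ⟨0, trivial, rfl⟩
    (by fin_cases j <;> simp [U, region])
  exact ⟨t, hz⟩

theorem isPreconnected_piece_natAdd (j : Fin 2) : IsPreconnected (piece (j.natAdd 7)) := by
  let e : ℝ × ℝ → ℝ × ℝ := fun q => (q.1, 0) + q.2 • dirVec j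
  have he : Continuous e := by fun_prop
  have hpre : IsPreconnected {q ∈ e ⁻¹' U (j.natAdd 7) | hessFn (e q) = 0} :=
    isPreconnected_zeros (φ' := fun q => dirDeriv (e q) (dirVec j)) ((isOpen_U _).preimage he)
      (fun s => ordConnected_line (j.natAdd 7) (s, 0) (dirVec j)) (continuous_hessFn.comp he)
      (fun s t => hasDerivAt_hessFn (s, 0) (dirVec j) t)
      (fun q hq h0 => dirDeriv_pos_of_wedge j hq h0) fun s => exists_mem_piece_line j s
  convert hpre.image e he.continuousOn
  have hne : (dirVec j).2 ≠ 0 := by fin_cases j <;> simp [dirVec, dir]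
  ext z
  constructor
  · rintro ⟨hU, h0⟩
    have hez : e (z.1 - z.2 / (dirVec j).2 * (dirVec j).1, z.2 / (dirVec j).2) = z := by
      ext <;> simp [e, hne]
    exact ⟨_, ⟨Set.mem_preimage.2 (by rwa [hez]), by rw [hez, h0]⟩, hez⟩
  · rintro ⟨q, hq, rfl⟩
    exact hq

theorem not_isBounded_piece (j : Fin 2) : ¬ Bornology.IsBounded (piece (j.natAdd 7)) := by
  intro hb
  obtain ⟨R, hR⟩ := hb.exists_norm_le
  obtain ⟨t, ht⟩ := exists_mem_piece_line j (2 * R + 1)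
  have h1 := (norm_fst_le _).trans (hR _ ht)
  have h2 := (norm_snd_le _).trans (hR _ ht)
  rw [Real.norm_eq_abs, abs_le] at h1 h2
  fin_cases j <;> simp [dirVec, dir] at h1 h2 <;> linarith

theorem isBounded_piece (i : Fin 7) : Bornology.IsBounded (piece (i.castAdd 2)) := by
  refine isBounded_iff_forall_norm_le.2 ⟨10, fun p hp => ?_⟩
  exact max_le (abs_le_of_mem_U hp.1).1 (abs_le_of_mem_U hp.1).2

theorem nonempty_piece (i : Fin 9) : (piece i).Nonempty :=
  Fin.addCases (m := 7) (n := 2) (motive := fun i => (piece i).Nonempty)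
    (fun i => let ⟨_, _, ht⟩ := exists_mem_piece_ray i 0; ⟨_, ht⟩)
    (fun j => let ⟨_, ht⟩ := exists_mem_piece_line j 0; ⟨_, ht⟩) i

theorem isPreconnected_piece (i : Fin 9) : IsPreconnected (piece i) :=
  Fin.addCases (m := 7) (n := 2) (motive := fun i => IsPreconnected (piece i))
    isPreconnected_piece_castAdd isPreconnected_piece_natAdd i

theorem injective_piece : Function.Injective piece := by
  intro i j hij
  by_contra hne
  obtain ⟨p, hp⟩ := nonempty_piece i
  exact Set.disjoint_left.1 (pairwise_disjoint_U hne) hp.1 (hij ▸ hp : p ∈ piece j).1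

theorem exists_mem_U_of_mem_Z {p : ℝ × ℝ} (hp : p ∈ Z) : ∃ i, p ∈ U i := by
  rw [Z_eq] at hp
  exact (hessFn_neg_or_mem_U p).resolve_left (show hessFn p = 0 from hp).not_lt

theorem connectedComponentIn_Z {i : Fin 9} {p : ℝ × ℝ} (hp : p ∈ piece i) :
    connectedComponentIn Z p = piece i := by
  have hsub : piece i ⊆ Z := fun q hq => Z_eq ▸ hq.2
  refine subset_antisymm (fun q hq => ?_)
    ((isPreconnected_piece i).subset_connectedComponentIn hp hsub)
  have hU : connectedComponentIn Z p ⊆ U i :=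
    isPreconnected_connectedComponentIn.subset_left_of_subset_union (isOpen_U i)
      (isOpen_biUnion (s := {j | j ≠ i}) fun j _ => isOpen_U j)
      (Set.disjoint_iUnion₂_right.2 fun j hj => pairwise_disjoint_U (Ne.symm hj))
      (fun z hz => by
        obtain ⟨j, hj⟩ := exists_mem_U_of_mem_Z (connectedComponentIn_subset Z p hz)
        by_cases hji : j = i
        · exact Or.inl (hji ▸ hj)
        · exact Or.inr (Set.mem_biUnion hji hj))
      ⟨p, mem_connectedComponentIn (hsub hp), hp.1⟩
  have hZ := connectedComponentIn_subset Z p hq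
  rw [Z_eq] at hZ
  exact ⟨hU hq, hZ⟩

theorem components_Z : components Z = Set.range piece := by
  ext C
  constructor
  · rintro ⟨p, hp, rfl⟩
    obtain ⟨i, hi⟩ := exists_mem_U_of_mem_Z hp
    rw [Z_eq] at hp
    exact ⟨i, (connectedComponentIn_Z ⟨hi, hp⟩).symm⟩
  · rintro ⟨i, rfl⟩
    obtain ⟨p, hp⟩ := nonempty_piece i
    exact ⟨p, Z_eq ▸ hp.2, (connectedComponentIn_Z hp).symm⟩

theorem isBounded_components_Z :
    {C ∈ components Z | Bornology.IsBounded C} =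
      Set.range fun i : Fin 7 => piece (i.castAdd 2) := by
  ext C
  constructor
  · rintro ⟨hC, hb⟩
    obtain ⟨i, rfl⟩ := components_Z ▸ hC
    induction i using Fin.addCases (m := 7) (n := 2) with
    | left i => exact ⟨i, rfl⟩
    | right j => exact absurd hb (not_isBounded_piece j)
  · rintro ⟨i, rfl⟩
    exact ⟨components_Z ▸ ⟨_, rfl⟩, isBounded_piece i⟩

theorem not_isBounded_components_Z :
    {C ∈ components Z | ¬ Bornology.IsBounded C} =
      Set.range fun j : Fin 2 => piece (j.natAdd 7) := by
  ext C
  constructor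
  · rintro ⟨hC, hb⟩
    obtain ⟨i, rfl⟩ := components_Z ▸ hC
    induction i using Fin.addCases (m := 7) (n := 2) with
    | left i => exact absurd (isBounded_piece i) hb
    | right j => exact ⟨j, rfl⟩
  · rintro ⟨j, rfl⟩
    exact ⟨components_Z ▸ ⟨_, rfl⟩, not_isBounded_piece j⟩

theorem ncard_range {α : Type*} {n : ℕ} {g : Fin n → α} (hg : Function.Injective g) :
    (Set.range g).ncard = n := by
  rw [← Set.image_univ, Set.ncard_image_of_injective _ hg, Set.ncard_univ, Nat.card_eq_fintype_card,
    Fintype.card_fin]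

end HessianCurve

/-- The hessian curve of `f` has exactly 9 connected components: 7 bounded (ovals)
and 2 unbounded. -/
theorem hessian_curve_components :
    (components Z).ncard = 9 ∧
    {C ∈ components Z | Bornology.IsBounded C}.ncard = 7 ∧
    {C ∈ components Z | ¬ Bornology.IsBounded C}.ncard = 2 := by
  rw [HessianCurve.isBounded_components_Z, HessianCurve.not_isBounded_components_Z,
    HessianCurve.components_Z]
  exact ⟨HessianCurve.ncard_range HessianCurve.injective_piece,
    HessianCurve.ncard_range (HessianCurve.injective_piece.comp (Fin.castAdd_injective 7 2)),
    HessianCurve.ncard_range (HessianCurve.injective_piece.comp (Fin.natAdd_injective 2 7))⟩
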